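/- Let Ω, Σ be non-isotropic weights on ℝ^N built from weight functions, and let g ∈ S_Ω^Σ(ℝ^N) with g ≠ 0. For a Schwartz function f ∈ S(ℝ^N) the following are equivalent: (1) f ∈ S_Ω^Σ(ℝ^N); (2) for every λ > 0 there exists C_λ > 0 such that |V_g f(x,ξ)| ≤ C_λ e^{−λ(Ω(x)+Σ(ξ))} for all (x,ξ) ∈ ℝ^{2N}. -/

import Mathlib

open MeasureTheory Filter
open scoped ENNReal NNReal

noncomputable section

/-- Euclidean pairing `x·ξ = ∑ x_j ξ_j`. -/
def dotR {M : ℕ} (x ξ : Fin M → ℝ) : ℝ := ∑ j, x j * ξ j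

/-- Fourier transform with kernel `e^{-i x·ξ}`. -/
def FT {M : ℕ} (f : (Fin M → ℝ) → ℂ) (ξ : Fin M → ℝ) : ℂ :=
  ∫ x, Complex.exp (-(Complex.I * (dotR x ξ : ℂ))) * f x

/-- sup-norm (in `ℝ≥0∞`) of a complex-valued function. -/
def supNorm {M : ℕ} (f : (Fin M → ℝ) → ℂ) : ℝ≥0∞ := ⨆ x, (‖f x‖₊ : ℝ≥0∞)

/-- partial derivative `∂_j`. -/
def pD {M : ℕ} (j : Fin M) (f : (Fin M → ℝ) → ℂ) : (Fin M → ℝ) → ℂ :=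
  fun x => fderiv ℝ f x (Pi.single j 1)

/-- iterated partial derivative `∂^α`. -/
def pDpow {M : ℕ} (α : Fin M → ℕ) (f : (Fin M → ℝ) → ℂ) : (Fin M → ℝ) → ℂ :=
  ((List.ofFn fun j : Fin M => (pD j)^[α j]).foldr (· ∘ ·) id) f

/-- `D^α = (-i)^{|α|} ∂^α`. -/
def Dpow {M : ℕ} (α : Fin M → ℕ) (f : (Fin M → ℝ) → ℂ) : (Fin M → ℝ) → ℂ :=
  fun x => (-Complex.I) ^ (∑ j, α j) * pDpow α f x

/-- multiplication by the monomial `x^α`. -/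
def monMul {M : ℕ} (α : Fin M → ℕ) (f : (Fin M → ℝ) → ℂ) : (Fin M → ℝ) → ℂ :=
  fun x => ((∏ j, (x j) ^ (α j) : ℝ) : ℂ) * f x

/-- Weight function in the sense of the paper (extended to `ℝ` by `ω x = ω |x|`):
continuous, increasing on `[0,∞)`, nonnegative, together with conditions
(α), (β), (γ), (δ). -/
structure IsWeightFun (ω : ℝ → ℝ) : Prop where
  nonneg : ∀ x, 0 ≤ ω x
  eq_abs : ∀ x, ω x = ω |x|
  continuous : Continuous ω
  mono : MonotoneOn ω (Set.Ici 0)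
  alphaCond : ∃ K, 1 ≤ K ∧ ∀ x, 0 ≤ x → ω (2 * x) ≤ K * (1 + ω x)
  betaCond : Filter.Tendsto (fun x => ω x / x) Filter.atTop (nhds 0)
  gammaCond : ∃ a b : ℝ, 0 < b ∧ ∀ x, 0 ≤ x → a + b * Real.log (1 + x) ≤ ω x
  deltaCond : ConvexOn ℝ (Set.Ici 0) fun t => ω (Real.exp t)

/-- non-isotropic weight `Ω(x) = ω_1(x_1) + ⋯ + ω_M(x_M)`. -/
def wSum {M : ℕ} (ω : Fin M → ℝ → ℝ) (x : Fin M → ℝ) : ℝ := ∑ j, ω j (x j)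

/-- Membership in the space `S_Ω^Σ(ℝ^M)`: `f ∈ L¹`, `f` and `f̂` smooth, and for
every `λ > 0` and every multi-index `α`, `‖e^{λΩ} D^α f‖_∞ < ∞` and
`‖e^{λΣ} D^α f̂‖_∞ < ∞`. -/
structure MemS {M : ℕ} (Om Sig : (Fin M → ℝ) → ℝ) (f : (Fin M → ℝ) → ℂ) : Prop where
  integrable : Integrable f
  smooth : ContDiff ℝ (⊤ : ℕ∞) f
  smooth_ft : ContDiff ℝ (⊤ : ℕ∞) (FT f)
  decay : ∀ lam : ℝ, 0 < lam → ∀ α : Fin M → ℕ,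
      supNorm (fun x => (Real.exp (lam * Om x) : ℂ) * Dpow α f x) < ⊤
  decay_ft : ∀ lam : ℝ, 0 < lam → ∀ α : Fin M → ℕ,
      supNorm (fun ξ => (Real.exp (lam * Sig ξ) : ℂ) * Dpow α (FT f) ξ) < ⊤

/-- short-time Fourier transform `V_g f(x,ξ) = ∫ e^{-i t·ξ} f(t) conj (g(t-x)) dt`. -/
def STFT {M : ℕ} (g f : (Fin M → ℝ) → ℂ) (x ξ : Fin M → ℝ) : ℂ :=
  ∫ t, Complex.exp (-(Complex.I * (dotR t ξ : ℂ))) * f t * (starRingEnd ℂ) (g (t - x))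


section Fourier

open FourierTransform

variable {M : ℕ}

lemma dotR_add_left (x y ξ : Fin M → ℝ) : dotR (x + y) ξ = dotR x ξ + dotR y ξ := by
  simp [dotR, add_mul, Finset.sum_add_distrib]

lemma dotR_comm (x ξ : Fin M → ℝ) : dotR x ξ = dotR ξ x := by
  simp [dotR, mul_comm]

lemma dotR_add_right (x ξ η : Fin M → ℝ) : dotR x (ξ + η) = dotR x ξ + dotR x η := by
  simp [dotR, mul_add, Finset.sum_add_distrib]

lemma dotR_smul_left (c : ℝ) (x ξ : Fin M → ℝ) : dotR (c • x) ξ = c * dotR x ξ := by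
  simp [dotR, Finset.mul_sum, mul_assoc]

lemma dotR_smul_right (c : ℝ) (x ξ : Fin M → ℝ) : dotR x (c • ξ) = c * dotR x ξ := by
  rw [dotR_comm, dotR_smul_left, dotR_comm]

lemma dotR_neg_right (x ξ : Fin M → ℝ) : dotR x (-ξ) = -dotR x ξ := by
  simp [dotR]

lemma continuous_dotR : Continuous fun p : (Fin M → ℝ) × (Fin M → ℝ) => dotR p.1 p.2 := by
  unfold dotR; fun_prop

lemma norm_exp_neg_I_mul (r : ℝ) : ‖Complex.exp (-(Complex.I * (r : ℂ)))‖ = 1 := by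
  rw [Complex.norm_exp]; simp

/-- The pairing `dotR` as a bilinear map. -/
def dotRBilin (M : ℕ) : (Fin M → ℝ) →ₗ[ℝ] (Fin M → ℝ) →ₗ[ℝ] ℝ :=
  LinearMap.mk₂ ℝ dotR dotR_add_left dotR_smul_left dotR_add_right dotR_smul_right

lemma FT_eq_vectorFourier (f : (Fin M → ℝ) → ℂ) :
    FT f = VectorFourier.fourierIntegral Real.probChar volume (dotRBilin M) f := by
  ext ξ
  rw [VectorFourier.fourierIntegral_probChar]
  simp [FT, dotRBilin, mul_comm]

lemma continuous_dotRBilin :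
    Continuous fun p : (Fin M → ℝ) × (Fin M → ℝ) => dotRBilin M p.1 p.2 :=
  continuous_dotR

lemma continuous_FT {f : (Fin M → ℝ) → ℂ} (hf : Integrable f) : Continuous (FT f) := by
  rw [FT_eq_vectorFourier]
  exact VectorFourier.fourierIntegral_continuous Real.continuous_probChar
    continuous_dotRBilin hf

lemma norm_FT_le (f : (Fin M → ℝ) → ℂ) (ξ : Fin M → ℝ) : ‖FT f ξ‖ ≤ ∫ x, ‖f x‖ := by
  rw [FT_eq_vectorFourier]
  exact VectorFourier.norm_fourierIntegral_le_integral_norm _ _ _ _ _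

lemma integral_FT_mul {f h : (Fin M → ℝ) → ℂ} (hf : Integrable f) (hh : Integrable h) :
    ∫ ξ, FT f ξ * h ξ = ∫ x, f x * FT h x := by
  have hflip : (dotRBilin M).flip = dotRBilin M := by
    ext; simp [dotRBilin, dotR_comm]
  have := VectorFourier.integral_fourierIntegral_smul_eq_flip (L := dotRBilin M)
    Real.continuous_probChar continuous_dotRBilin hf hh (μ := volume) (ν := volume)
  simpa [FT_eq_vectorFourier, hflip] using this

lemma FT_eq_fourier (f : (Fin M → ℝ) → ℂ) (ξ : Fin M → ℝ) :
    FT f ξ = 𝓕 (fun x : EuclideanSpace ℝ (Fin M) => f (WithLp.ofLp x))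
      (WithLp.toLp 2 ((2 * Real.pi)⁻¹ • ξ)) := by
  rw [Real.fourier_eq', ← (PiLp.volume_preserving_toLp (Fin M)).integral_comp
    (MeasurableEquiv.toLp 2 (Fin M → ℝ)).measurableEmbedding]
  refine integral_congr_ae (ae_of_all _ fun x => ?_)
  have : (inner ℝ (WithLp.toLp 2 x) (WithLp.toLp 2 ((2 * Real.pi)⁻¹ • ξ)) : ℝ)
      = (2 * Real.pi)⁻¹ * dotR x ξ := by
    simp [PiLp.inner_apply, dotR, Finset.mul_sum]
    exact Finset.sum_congr rfl fun _ _ => by ring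
  simp only [this, smul_eq_mul]
  congr 2
  push_cast
  have := Real.pi_ne_zero
  field_simp

/-- The Fourier transform `FT` on Schwartz functions. -/
def schwartzFT (f : SchwartzMap (Fin M → ℝ) ℂ) : SchwartzMap (Fin M → ℝ) ℂ :=
  SchwartzMap.compCLMOfContinuousLinearEquiv ℂ
    ((ContinuousLinearEquiv.smulLeft
      (Units.mk0 (2 * Real.pi)⁻¹ (inv_ne_zero Real.two_pi_pos.ne'))).trans
      (PiLp.continuousLinearEquiv 2 ℝ fun _ : Fin M => ℝ).symm)
    (𝓕 (SchwartzMap.compCLMOfContinuousLinearEquiv ℂ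
      (PiLp.continuousLinearEquiv 2 ℝ fun _ : Fin M => ℝ) f))

lemma coe_schwartzFT (f : SchwartzMap (Fin M → ℝ) ℂ) : ⇑(schwartzFT f) = FT f := by
  ext ξ
  rw [FT_eq_fourier]
  rfl

lemma FT_FT {f : (Fin M → ℝ) → ℂ} (hc : Continuous f) (hf : Integrable f)
    (hf' : Integrable (FT f)) (t : Fin M → ℝ) :
    FT (FT f) t = (2 * Real.pi) ^ M * f (-t) := by
  have h2 : (0 : ℝ) < 2 * Real.pi := Real.two_pi_pos
  set F : EuclideanSpace ℝ (Fin M) → ℂ := fun x => f (WithLp.ofLp x) with hF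
  have hFc : Continuous F := hc.comp (PiLp.continuous_ofLp 2 _)
  have hFi : Integrable F := (PiLp.volume_preserving_ofLp (Fin M)).integrable_comp_of_integrable hf
  have key : ∀ y : Fin M → ℝ, 𝓕 F (WithLp.toLp 2 y) = FT f ((2 * Real.pi) • y) := fun y => by
    rw [FT_eq_fourier, inv_smul_smul₀ h2.ne']
  have hFi' : Integrable (𝓕 F) := by
    rw [← (PiLp.volume_preserving_toLp (Fin M)).integrable_comp_emb
      (MeasurableEquiv.toLp 2 (Fin M → ℝ)).measurableEmbedding]
    have : (𝓕 F ∘ WithLp.toLp 2) = fun y => FT f ((2 * Real.pi) • y) := funext key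
    rw [this]
    exact hf'.comp_smul h2.ne'
  have inv := congrFun (hFc.fourierInv_fourier_eq hFi hFi') (WithLp.toLp 2 (-t))
  rw [Real.fourierInv_eq', ← (PiLp.volume_preserving_toLp (Fin M)).integral_comp
    (MeasurableEquiv.toLp 2 (Fin M → ℝ)).measurableEmbedding] at inv
  have hcv := Measure.integral_comp_smul (volume : Measure (Fin M → ℝ))
    (fun x => Complex.exp (-(Complex.I * (dotR x t : ℂ))) * FT f x) (2 * Real.pi)
  have : ∀ y : Fin M → ℝ,
      Complex.exp (((2 * Real.pi * inner ℝ (WithLp.toLp 2 y) (WithLp.toLp 2 (-t)) : ℝ) : ℂ)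
        * Complex.I) • 𝓕 F (WithLp.toLp 2 y)
      = Complex.exp (-(Complex.I * (dotR ((2 * Real.pi) • y) t : ℂ)))
        * FT f ((2 * Real.pi) • y) := fun y => by
    rw [key, smul_eq_mul]
    have : (inner ℝ (WithLp.toLp 2 y) (WithLp.toLp 2 (-t)) : ℝ) = - dotR y t := by
      simp [PiLp.inner_apply, dotR, mul_comm]
    rw [this, dotR_smul_left]
    congr 2
    push_cast
    ring
  simp only [this] at inv
  rw [hcv] at inv
  change _ = f (-t) at inv
  rw [← inv]
  change FT (FT f) t = _ * (_ • FT (FT f) t)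
  rw [Module.finrank_fin_fun, abs_of_pos (by positivity), Complex.real_smul]
  push_cast
  have : (Real.pi : ℂ) ≠ 0 := by exact_mod_cast Real.pi_ne_zero
  field_simp

end Fourier

section Decay

variable {M : ℕ}

/-- The properties of a non-isotropic weight on which decay estimates rely. -/
structure IsTamedWeight (W : (Fin M → ℝ) → ℝ) : Prop where
  nonneg : ∀ x, 0 ≤ W x
  neg : ∀ x, W (-x) = W x
  continuous : Continuous W
  growth : ∃ C c : ℝ, 0 < C ∧ 0 < c ∧ ∀ x, 1 + ‖x‖ ≤ C * Real.exp (c * W x)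
  add_le : ∃ K : ℝ, 0 < K ∧ ∀ x y, W (x + y) ≤ K * (1 + W x + W y)

/-- Decay of `f` faster than every `e^{-λW}`. -/
def ExpDecay (W : (Fin M → ℝ) → ℝ) (f : (Fin M → ℝ) → ℂ) : Prop :=
  ∀ lam : ℝ, 0 < lam → ∃ C : ℝ, 0 < C ∧ ∀ x, ‖f x‖ ≤ C * Real.exp (-(lam * W x))

lemma wSum_nonneg {ω : Fin M → ℝ → ℝ} (hω : ∀ j, IsWeightFun (ω j)) (x : Fin M → ℝ) :
    0 ≤ wSum ω x :=
  Finset.sum_nonneg fun j _ => (hω j).nonneg _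

lemma one_add_norm_le_exp_sum_log (x : Fin M → ℝ) :
    1 + ‖x‖ ≤ Real.exp (∑ j, Real.log (1 + |x j|)) := by
  have hpos : ∀ j, 0 ≤ Real.log (1 + |x j|) := fun j =>
    Real.log_nonneg (by linarith [abs_nonneg (x j)])
  have h0 : 0 ≤ ∑ j, Real.log (1 + |x j|) := Finset.sum_nonneg fun j _ => hpos j
  have : ‖x‖ ≤ Real.exp (∑ j, Real.log (1 + |x j|)) - 1 := by
    refine (pi_norm_le_iff_of_nonneg (by linarith [Real.one_le_exp h0])).2 fun j => ?_
    have h1 : Real.log (1 + |x j|) ≤ ∑ j, Real.log (1 + |x j|) :=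
      Finset.single_le_sum (f := fun j => Real.log (1 + |x j|)) (fun j _ => hpos j)
        (Finset.mem_univ j)
    have h2 := Real.exp_le_exp.2 h1
    rw [Real.exp_log (by positivity)] at h2
    rw [Real.norm_eq_abs]
    linarith
  linarith

lemma IsWeightFun.exists_log_le {ω : ℝ → ℝ} (h : IsWeightFun ω) :
    ∃ A B : ℝ, 0 ≤ A ∧ 0 ≤ B ∧ ∀ x, Real.log (1 + |x|) ≤ A + B * ω x := by
  obtain ⟨a, b, hb, hab⟩ := h.gammaCond
  refine ⟨|a| / b, 1 / b, by positivity, by positivity, fun x => ?_⟩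
  have h1 := hab |x| (abs_nonneg x)
  rw [← h.eq_abs] at h1
  have h2 : Real.log (1 + |x|) * b ≤ |a| + ω x := by linarith [neg_abs_le a]
  calc Real.log (1 + |x|) ≤ (|a| + ω x) / b := (le_div_iff₀ hb).2 h2
    _ = _ := by ring

lemma IsWeightFun.exists_add_le {ω : ℝ → ℝ} (h : IsWeightFun ω) :
    ∃ K : ℝ, 0 ≤ K ∧ ∀ x y, ω (x + y) ≤ K * (1 + ω x + ω y) := by
  obtain ⟨K, hK, hdouble⟩ := h.alphaCond
  refine ⟨K, by linarith, fun x y => ?_⟩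
  have key : ∀ r s : ℝ, |r| ≤ |s| → ω (r + s) ≤ K * (1 + ω s) := fun r s hrs => by
    rw [h.eq_abs (r + s), h.eq_abs s]
    refine le_trans (h.mono (Set.mem_Ici.2 (abs_nonneg _)) (by simp) ?_) (hdouble _ (abs_nonneg s))
    linarith [abs_add_le r s]
  rcases le_total |x| |y| with hxy | hxy
  · refine (key x y hxy).trans (mul_le_mul_of_nonneg_left ?_ (by linarith))
    linarith [h.nonneg x]
  · rw [add_comm x y]
    refine (key y x hxy).trans (mul_le_mul_of_nonneg_left ?_ (by linarith))
    linarith [h.nonneg y]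

lemma isTamedWeight_wSum {ω : Fin M → ℝ → ℝ} (hω : ∀ j, IsWeightFun (ω j)) :
    IsTamedWeight (wSum ω) where
  nonneg := wSum_nonneg hω
  neg x := Finset.sum_congr rfl fun j _ => by
    rw [(hω j).eq_abs, (hω j).eq_abs (x j), Pi.neg_apply, abs_neg]
  continuous := continuous_finsetSum _ fun j _ => (hω j).continuous.comp (continuous_apply j)
  growth := by
    choose A B hA hB hlog using fun j => (hω j).exists_log_le
    have hB0 : 0 ≤ ∑ j, B j := Finset.sum_nonneg fun j _ => hB j
    refine ⟨Real.exp (∑ j, A j), ∑ j, B j + 1, Real.exp_pos _, by linarith, fun x => ?_⟩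
    rw [← Real.exp_add]
    refine (one_add_norm_le_exp_sum_log x).trans (Real.exp_le_exp.2 ?_)
    calc ∑ j, Real.log (1 + |x j|) ≤ ∑ j, (A j + (∑ i, B i) * ω j (x j)) :=
          Finset.sum_le_sum fun j _ => (hlog j _).trans <| by
            gcongr
            · exact (hω j).nonneg _
            · exact Finset.single_le_sum (fun i _ => hB i) (Finset.mem_univ j)
      _ = ∑ j, A j + (∑ j, B j) * wSum ω x := by
          rw [Finset.sum_add_distrib, wSum, Finset.mul_sum]
      _ ≤ _ := by nlinarith [wSum_nonneg hω x]
  add_le := by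
    choose K hK hadd using fun j => (hω j).exists_add_le
    have hK0 : 0 ≤ ∑ j, K j := Finset.sum_nonneg fun j _ => hK j
    refine ⟨(∑ j, K j + 1) * (M + 1), by positivity, fun x y => ?_⟩
    have hx := wSum_nonneg hω x
    have hy := wSum_nonneg hω y
    calc wSum ω (x + y) ≤ ∑ j, (∑ i, K i) * (1 + ω j (x j) + ω j (y j)) :=
          Finset.sum_le_sum fun j _ => (hadd j _ _).trans <| by
            gcongr
            · linarith [(hω j).nonneg (x j), (hω j).nonneg (y j)]
            · exact Finset.single_le_sum (fun i _ => hK i) (Finset.mem_univ j)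
      _ = (∑ i, K i) * (M + wSum ω x + wSum ω y) := by
          rw [← Finset.mul_sum, Finset.sum_add_distrib, Finset.sum_add_distrib]
          simp [wSum]
      _ ≤ (∑ j, K j + 1) * ((M + 1) * (1 + wSum ω x + wSum ω y)) := by
          gcongr
          · linarith
          · have : (0 : ℝ) ≤ M := M.cast_nonneg
            nlinarith
      _ = _ := by ring

namespace IsTamedWeight

variable {W : (Fin M → ℝ) → ℝ}

lemma exists_integrable (hW : IsTamedWeight W) :
    ∃ lam : ℝ, 0 < lam ∧ Integrable fun x => Real.exp (-(lam * W x)) := by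
  obtain ⟨C, c, hC, hc, h⟩ := hW.growth
  have hint := integrable_one_add_norm (E := Fin M → ℝ) (μ := volume) (r := M + 1)
    (by rw [Module.finrank_fin_fun]; linarith)
  refine ⟨c * (M + 1), by positivity, (hint.const_mul (C ^ ((M : ℝ) + 1))).mono' ?_ ?_⟩
  · exact (Real.continuous_exp.comp
      (continuous_const.mul hW.continuous).neg).aestronglyMeasurable
  · refine ae_of_all _ fun x => ?_
    have hx : 0 < 1 + ‖x‖ := by positivity
    have h1 := Real.rpow_le_rpow hx.le (h x) (by positivity : (0 : ℝ) ≤ M + 1)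
    rw [Real.mul_rpow hC.le (Real.exp_pos _).le, ← Real.exp_mul] at h1
    rw [Real.norm_of_nonneg (Real.exp_pos _).le, Real.rpow_neg hx.le, Real.exp_neg,
      ← div_eq_mul_inv, inv_eq_one_div, div_le_div_iff₀ (Real.exp_pos _) (by positivity), one_mul]
    rwa [mul_right_comm c]

lemma exists_le_sub (hW : IsTamedWeight W) :
    ∃ K : ℝ, 0 < K ∧ ∀ x y, W x ≤ K * (1 + W y + W (x - y)) := by
  obtain ⟨K, hK, h⟩ := hW.add_le
  exact ⟨K, hK, fun x y => by simpa using h y (x - y)⟩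

lemma sub_comm (hW : IsTamedWeight W) (x y : Fin M → ℝ) : W (x - y) = W (y - x) := by
  rw [← hW.neg, neg_sub]

end IsTamedWeight

namespace ExpDecay

variable {W : (Fin M → ℝ) → ℝ} {f g : (Fin M → ℝ) → ℂ}

lemma integrable (hW : IsTamedWeight W) (hf : ExpDecay W f) (hc : Continuous f) :
    Integrable f := by
  obtain ⟨l, hl, hint⟩ := hW.exists_integrable
  obtain ⟨C, -, hC⟩ := hf l hl
  exact (hint.const_mul C).mono' hc.aestronglyMeasurable (ae_of_all _ hC)

lemma exists_bound (hW : IsTamedWeight W) (hf : ExpDecay W f) : ∃ C, ∀ x, ‖f x‖ ≤ C := by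
  obtain ⟨C, hC0, hC⟩ := hf 1 one_pos
  refine ⟨C, fun x => (hC x).trans (mul_le_of_le_one_right hC0.le ?_)⟩
  exact Real.exp_le_one_iff.2 (by linarith [hW.nonneg x])

/-- Decay of `V_g f` in the time variable. -/
lemma norm_STFT_le (hW : IsTamedWeight W) (hf : ExpDecay W f) (hg : ExpDecay W g)
    {lam : ℝ} (hlam : 0 < lam) :
    ∃ C : ℝ, 0 < C ∧ ∀ x ξ, ‖STFT g f x ξ‖ ≤ C * Real.exp (-(lam * W x)) := by
  obtain ⟨l, hl, hint⟩ := hW.exists_integrable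
  obtain ⟨K, hK, hsub⟩ := hW.exists_le_sub
  obtain ⟨C₁, hC₁, h₁⟩ := hf (lam * K + l) (by positivity)
  obtain ⟨C₂, hC₂, h₂⟩ := hg (lam * K) (by positivity)
  set D := C₁ * C₂ * Real.exp (lam * K)
  have hD : 0 < D := by positivity
  have hI : 0 ≤ ∫ t, Real.exp (-(l * W t)) := integral_nonneg fun _ => (Real.exp_pos _).le
  refine ⟨D * ((∫ t, Real.exp (-(l * W t))) + 1), by positivity, fun x ξ => ?_⟩
  have key : ∀ t, ‖Complex.exp (-(Complex.I * (dotR t ξ : ℂ))) * f t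
      * (starRingEnd ℂ) (g (t - x))‖
      ≤ D * Real.exp (-(lam * W x)) * Real.exp (-(l * W t)) := fun t => by
    rw [norm_mul, norm_mul, norm_exp_neg_I_mul, one_mul, RCLike.norm_conj]
    refine (mul_le_mul (h₁ t) (h₂ (t - x)) (norm_nonneg _) (by positivity)).trans ?_
    have e1 : C₁ * Real.exp (-((lam * K + l) * W t)) * (C₂ * Real.exp (-(lam * K * W (t - x))))
        = C₁ * C₂ * Real.exp (-((lam * K + l) * W t) + -(lam * K * W (t - x))) := by
      rw [Real.exp_add]; ring
    have e2 : D * Real.exp (-(lam * W x)) * Real.exp (-(l * W t))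
        = C₁ * C₂ * Real.exp (lam * K + -(lam * W x) + -(l * W t)) := by
      rw [Real.exp_add, Real.exp_add]; ring
    rw [e1, e2]
    refine mul_le_mul_of_nonneg_left (Real.exp_le_exp.2 ?_) (by positivity)
    have := mul_le_mul_of_nonneg_left (hsub x t) hlam.le
    rw [hW.sub_comm x t] at this
    linarith
  refine (norm_integral_le_of_norm_le (hint.const_mul _) (ae_of_all _ key)).trans ?_
  rw [integral_const_mul]
  have := mul_pos hD (Real.exp_pos (-(lam * W x)))
  nlinarith

end ExpDecay

lemma STFT_eq_FT (g f : (Fin M → ℝ) → ℂ) (x : Fin M → ℝ) :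
    STFT g f x = FT fun t => f t * (starRingEnd ℂ) (g (t - x)) := by
  ext ξ
  simp only [STFT, FT, mul_assoc]

/-- The fundamental identity of time-frequency analysis. -/
lemma STFT_FT {f g : (Fin M → ℝ) → ℂ} (hf : Integrable f) (hgc : Continuous g)
    (hg : Integrable g) (hg' : Integrable (FT g)) (ξ y : Fin M → ℝ) :
    STFT (FT g) (FT f) ξ y
      = (2 * Real.pi) ^ M * Complex.exp (-(Complex.I * (dotR ξ y : ℂ))) * STFT g f (-y) ξ := by
  set h : (Fin M → ℝ) → ℂ := fun t =>
    Complex.exp (-(Complex.I * (dotR t y : ℂ))) * (starRingEnd ℂ) (FT g (t - ξ)) with hh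
  have hexp : Continuous fun t : Fin M → ℝ => Complex.exp (-(Complex.I * (dotR t y : ℂ))) := by
    unfold dotR; fun_prop
  have hhc : Continuous h := hexp.mul <| Complex.continuous_conj.comp <|
    (continuous_FT hg).comp (continuous_id.sub continuous_const)
  have hhi : Integrable h := by
    refine (hg'.comp_sub_right ξ).mono hhc.aestronglyMeasurable (ae_of_all _ fun t => ?_)
    rw [hh, norm_mul, norm_exp_neg_I_mul, one_mul, RCLike.norm_conj]
  have hFT : ∀ s, FT h s = (2 * Real.pi) ^ M * Complex.exp (-(Complex.I * (dotR ξ y : ℂ)))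
      * (Complex.exp (-(Complex.I * (dotR s ξ : ℂ))) * (starRingEnd ℂ) (g (s - -y))) := fun s => by
    have e1 : FT h s = ∫ t, Complex.exp (-(Complex.I * (dotR ξ (s + y) : ℂ))) *
        (starRingEnd ℂ) (Complex.exp (-(Complex.I * (dotR t (-(s + y)) : ℂ))) * FT g t) := by
      rw [FT, ← integral_add_right_eq_self _ ξ]
      refine integral_congr_ae (ae_of_all _ fun t => ?_)
      simp only [hh, add_sub_cancel_right, map_mul, ← Complex.exp_conj, ← mul_assoc,
        ← Complex.exp_add]
      congr 2
      simp only [dotR_add_left, dotR_add_right, dotR_neg_right, map_neg, map_mul, Complex.conj_I,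
        Complex.conj_ofReal]
      push_cast
      ring
    rw [e1, integral_const_mul, integral_conj]
    change _ * (starRingEnd ℂ) (FT (FT g) (-(s + y))) = _
    rw [FT_FT hgc hg hg', neg_neg, map_mul, sub_neg_eq_add, dotR_add_right, dotR_comm s ξ]
    have : (starRingEnd ℂ) ((2 * (Real.pi : ℂ)) ^ M) = (2 * (Real.pi : ℂ)) ^ M := by
      rw [map_pow, map_mul, Complex.conj_ofReal, map_ofNat]
    rw [this]
    push_cast
    rw [mul_add, neg_add, Complex.exp_add]
    ring
  have e2 : STFT (FT g) (FT f) ξ y = ∫ t, FT f t * h t :=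
    integral_congr_ae (ae_of_all _ fun t => by simp only [hh]; ring)
  rw [e2, integral_FT_mul hf hhi, STFT, ← integral_const_mul]
  refine integral_congr_ae (ae_of_all _ fun s => ?_)
  simp only [hFT]
  ring

/-- Decay of `V_g f` in both variables forces decay of `f`. -/
lemma expDecay_of_norm_STFT_le {W V : (Fin M → ℝ) → ℝ} (hW : IsTamedWeight W)
    (hV : IsTamedWeight V) {f g : (Fin M → ℝ) → ℂ} (hfc : Continuous f) (hf : Integrable f)
    (hgc : Continuous g) (hgb : ∃ C, ∀ x, ‖g x‖ ≤ C) (hg0 : g ≠ 0)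
    (h : ∀ lam : ℝ, 0 < lam → ∃ C : ℝ, 0 < C ∧ ∀ x ξ,
      ‖STFT g f x ξ‖ ≤ C * Real.exp (-(lam * (W x + V ξ)))) :
    ExpDecay W f := by
  intro lam hlam
  obtain ⟨t₀, ht₀⟩ := Function.ne_iff.1 hg0
  have ht₀' : 0 < ‖g t₀‖ := norm_pos_iff.2 ht₀
  obtain ⟨l, hl, hint⟩ := hV.exists_integrable
  obtain ⟨K, hK, hsub⟩ := hW.exists_le_sub
  obtain ⟨C, hC, hS⟩ := h (lam * K + l) (by positivity)
  obtain ⟨B, hB⟩ := hgb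
  set I := ∫ ξ, Real.exp (-(l * V ξ))
  have hI : 0 ≤ I := integral_nonneg fun _ => (Real.exp_pos _).le
  have hpi : (0 : ℝ) < (2 * Real.pi) ^ M := by have := Real.pi_pos; positivity
  have hbound : ∀ t x, (2 * Real.pi) ^ M * (‖f t‖ * ‖g (t - x)‖)
      ≤ C * Real.exp (-(lam * K * W x)) * I := fun t x => by
    set k : (Fin M → ℝ) → ℂ := fun t => f t * (starRingEnd ℂ) (g (t - x)) with hk
    have hgx : Continuous fun t => (starRingEnd ℂ) (g (t - x)) :=
      Complex.continuous_conj.comp (hgc.comp (continuous_id.sub continuous_const))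
    have hkc : Continuous k := hfc.mul hgx
    have hki : Integrable k := hf.mul_bdd (c := B) hgx.aestronglyMeasurable
      (ae_of_all _ fun t => by rw [RCLike.norm_conj]; exact hB _)
    have hFT : ∀ ξ, ‖FT k ξ‖ ≤ C * Real.exp (-(lam * K * W x)) * Real.exp (-(l * V ξ)) :=
      fun ξ => by
        rw [hk, ← STFT_eq_FT]
        refine (hS x ξ).trans ?_
        rw [mul_assoc, ← Real.exp_add]
        gcongr
        nlinarith [mul_nonneg hl.le (hW.nonneg x),
          mul_nonneg (mul_pos hlam hK).le (hV.nonneg ξ)]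
    have hFTi : Integrable (FT k) := (hint.const_mul _).mono'
      (continuous_FT hki).aestronglyMeasurable (ae_of_all _ hFT)
    have e : ‖FT (FT k) (-t)‖ = (2 * Real.pi) ^ M * (‖f t‖ * ‖g (t - x)‖) := by
      rw [FT_FT hkc hki hFTi, neg_neg, norm_mul, hk, norm_mul, RCLike.norm_conj, norm_pow,
        norm_mul, Complex.norm_real, Complex.norm_ofNat, Real.norm_of_nonneg Real.pi_pos.le]
    rw [← e]
    refine (norm_FT_le _ _).trans ?_
    rw [← integral_const_mul]
    exact integral_mono hFTi.norm (hint.const_mul _) hFT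
  set D := C * (I + 1) * Real.exp (lam * K * (1 + W t₀)) / ((2 * Real.pi) ^ M * ‖g t₀‖)
  refine ⟨D, by positivity, fun t => ?_⟩
  have h1 := hbound t (t - t₀)
  rw [sub_sub_cancel] at h1
  have h2 : Real.exp (-(lam * K * W (t - t₀)))
      ≤ Real.exp (lam * K * (1 + W t₀)) * Real.exp (-(lam * W t)) := by
    rw [← Real.exp_add]
    gcongr
    have := mul_le_mul_of_nonneg_left (hsub t t₀) hlam.le
    linarith
  have h3 : ‖f t‖ * ((2 * Real.pi) ^ M * ‖g t₀‖)
      ≤ C * (I + 1) * Real.exp (lam * K * (1 + W t₀)) * Real.exp (-(lam * W t)) := calc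
    _ = (2 * Real.pi) ^ M * (‖f t‖ * ‖g t₀‖) := by ring
    _ ≤ C * Real.exp (-(lam * K * W (t - t₀))) * I := h1
    _ ≤ C * (Real.exp (lam * K * (1 + W t₀)) * Real.exp (-(lam * W t))) * (I + 1) := by
      gcongr; linarith
    _ = _ := by ring
  rw [div_mul_eq_mul_div]
  exact (le_div_iff₀ (by positivity)).2 h3

end Decay

section Derivatives

open LineDeriv

variable {M : ℕ} {W : (Fin M → ℝ) → ℝ}

lemma coe_lineDeriv_eq_pD (j : Fin M) (F : SchwartzMap (Fin M → ℝ) ℂ) :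
    ⇑(∂_{(Pi.single j 1 : Fin M → ℝ)} F : SchwartzMap (Fin M → ℝ) ℂ) = pD j F := rfl

/-- A Landau-Kolmogorov type interpolation estimate. -/
lemma ExpDecay.lineDeriv (hW : IsTamedWeight W) {F : SchwartzMap (Fin M → ℝ) ℂ}
    (hF : ExpDecay W F) (m : Fin M → ℝ) : ExpDecay W ⇑(∂_{m} F : SchwartzMap (Fin M → ℝ) ℂ) := by
  intro lam hlam
  obtain ⟨K, hK, hadd⟩ := hW.add_le
  obtain ⟨B, hB⟩ := (isCompact_Icc (a := (0 : ℝ)) (b := 1)).bddAbove_image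
    (f := fun h : ℝ => W (h • m)) (hW.continuous.comp (by fun_prop)).continuousOn
  have hB : ∀ h ∈ Set.Icc (0 : ℝ) 1, W (h • m) ≤ B := fun h hh => hB (Set.mem_image_of_mem _ hh)
  obtain ⟨C₁, hC₁, h₁⟩ := hF (2 * lam) (by positivity)
  obtain ⟨C₂, hC₂, h₂⟩ := hF (2 * lam * K) (by positivity)
  set G := SchwartzMap.fderivCLM ℝ (Fin M → ℝ) ℂ F
  obtain ⟨L, hL, hLip⟩ : ∃ L : ℝ, 0 < L ∧ ∀ x y, ‖G y - G x‖ ≤ L * ‖y - x‖ := by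
    obtain ⟨L, hL, h⟩ := (SchwartzMap.fderivCLM ℝ (Fin M → ℝ) _ G).decay 0 0
    refine ⟨L, hL, fun x y => ?_⟩
    refine convex_univ.norm_image_sub_le_of_norm_fderiv_le (𝕜 := ℝ)
      (fun z _ => G.differentiableAt) (fun z _ => ?_) (Set.mem_univ x) (Set.mem_univ y)
    simpa using h z
  set D := C₁ + C₂ * Real.exp (2 * lam * K * (1 + B)) + L * ‖m‖ * ‖m‖
  refine ⟨D, by positivity, fun x => ?_⟩
  set h := Real.exp (-(lam * W x)) with hh
  have hpos : 0 < h := Real.exp_pos _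
  have hle : h ≤ 1 := Real.exp_le_one_iff.2 (by nlinarith [hW.nonneg x])
  have hsq : Real.exp (-(2 * lam * W x)) = h * h := by
    rw [hh, ← Real.exp_add]; congr 1; ring
  have hFx : ‖F x‖ ≤ C₁ * (h * h) := hsq ▸ h₁ x
  have hFh : ‖F (x + h • m)‖ ≤ C₂ * Real.exp (2 * lam * K * (1 + B)) * (h * h) := by
    refine (h₂ _).trans ?_
    rw [← hsq, mul_assoc C₂, ← Real.exp_add]
    gcongr
    have e := hadd (x + h • m) (-(h • m))
    rw [add_neg_cancel_right, hW.neg] at e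
    have e' := hB h ⟨hpos.le, hle⟩
    have : W x ≤ K * (1 + W (x + h • m) + B) := e.trans (by gcongr)
    have := mul_le_mul_of_nonneg_left this (by positivity : 0 ≤ 2 * lam)
    linarith
  have hT : ‖F (x + h • m) - F x - G x (h • m)‖ ≤ L * (h * ‖m‖) * (h * ‖m‖) := by
    have hn : ‖h • m‖ = h * ‖m‖ := by rw [norm_smul, Real.norm_of_nonneg hpos.le]
    have := (convex_segment x (x + h • m)).norm_image_sub_le_of_norm_fderiv_le' (𝕜 := ℝ)
      (f := F) (φ := G x) (C := L * (h * ‖m‖)) (fun z _ => F.differentiableAt)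
      (fun z hz => ?_) (left_mem_segment ℝ _ _) (right_mem_segment ℝ _ _)
    · simpa [hn] using this
    · change ‖G z - G x‖ ≤ _
      refine (hLip x z).trans (mul_le_mul_of_nonneg_left ?_ hL.le)
      have := norm_sub_le_of_mem_segment hz
      simpa [hn] using this
  have hder : h * ‖G x m‖ ≤ D * h * h := by
    have e : ‖G x (h • m)‖ = h * ‖G x m‖ := by
      rw [map_smul, norm_smul, Real.norm_of_nonneg hpos.le]
    rw [← e]
    have := norm_sub_le (F (x + h • m) - F x) (F (x + h • m) - F x - G x (h • m))
    rw [sub_sub_cancel] at this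
    have := norm_sub_le (F (x + h • m)) (F x)
    linarith
  rw [mul_assoc, mul_comm D, mul_assoc] at hder
  have := le_of_mul_le_mul_left hder hpos
  rwa [mul_comm] at this

lemma pDpow_induction {P : ((Fin M → ℝ) → ℂ) → Prop} (hP : ∀ j f, P f → P (pD j f))
    (α : Fin M → ℕ) {f : (Fin M → ℝ) → ℂ} (hf : P f) : P (pDpow α f) := by
  have : ∀ l : List (((Fin M → ℝ) → ℂ) → ((Fin M → ℝ) → ℂ)), (∀ T ∈ l, ∀ f, P f → P (T f)) →
      P (l.foldr (· ∘ ·) id f) := by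
    intro l
    induction l with
    | nil => exact fun _ => hf
    | cons T l ih =>
      exact fun h => h T (by simp) _ (ih fun S hS => h S (by simp [hS]))
  refine this _ fun T hT => ?_
  obtain ⟨j, rfl⟩ := List.mem_ofFn.1 hT
  intro f hf
  induction α j with
  | zero => exact hf
  | succ n ih => rw [Function.iterate_succ_apply']; exact hP j _ ih

lemma Dpow_zero (f : (Fin M → ℝ) → ℂ) : Dpow 0 f = f := by
  have : ∀ n, (List.replicate n id).foldr (· ∘ ·) (id : ((Fin M → ℝ) → ℂ) → _) = id := by
    intro n
    induction n with
    | zero => rfl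
    | succ n ih => simp [List.replicate_succ, ih]
  ext x
  simp [Dpow, pDpow, List.ofFn_const, this]

lemma ExpDecay.Dpow (hW : IsTamedWeight W) {F : SchwartzMap (Fin M → ℝ) ℂ}
    (hF : ExpDecay W F) (α : Fin M → ℕ) : ExpDecay W (Dpow α F) := by
  obtain ⟨G, hG, hd⟩ := pDpow_induction
    (P := fun f => ∃ G : SchwartzMap (Fin M → ℝ) ℂ, ⇑G = f ∧ ExpDecay W f)
    (by rintro j _ ⟨G, rfl, hG⟩; exact ⟨_, coe_lineDeriv_eq_pD j G, hG.lineDeriv hW _⟩)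
    α ⟨F, rfl, hF⟩
  intro lam hlam
  obtain ⟨C, hC, h⟩ := hd lam hlam
  refine ⟨C, hC, fun x => ?_⟩
  simpa [_root_.Dpow] using h x

lemma supNorm_lt_top_iff (f : (Fin M → ℝ) → ℂ) :
    supNorm f < ⊤ ↔ ∃ C : ℝ, 0 < C ∧ ∀ x, ‖f x‖ ≤ C := by
  constructor
  · intro h
    refine ⟨(supNorm f).toReal + 1, by positivity, fun x => ?_⟩
    have h1 : (‖f x‖₊ : ℝ≥0∞) ≤ supNorm f := le_iSup (fun x => (‖f x‖₊ : ℝ≥0∞)) x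
    have h2 := ENNReal.toReal_mono h.ne h1
    rw [ENNReal.coe_toReal, coe_nnnorm] at h2
    linarith
  · rintro ⟨C, hC, h⟩
    refine lt_of_le_of_lt (iSup_le fun x => ?_) (ENNReal.ofReal_lt_top (r := C))
    rw [← enorm_eq_nnnorm, ← ofReal_norm]
    exact ENNReal.ofReal_le_ofReal (h x)

lemma expDecay_iff_supNorm (f : (Fin M → ℝ) → ℂ) :
    ExpDecay W f ↔
      ∀ lam : ℝ, 0 < lam → supNorm (fun x => (Real.exp (lam * W x) : ℂ) * f x) < ⊤ := by
  refine forall₂_congr fun lam _ => ?_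
  rw [supNorm_lt_top_iff]
  refine exists_congr fun C => and_congr_right fun _ => forall_congr' fun x => ?_
  rw [norm_mul, Complex.norm_real, Real.norm_of_nonneg (Real.exp_pos _).le, Real.exp_neg,
    ← div_eq_mul_inv, le_div_iff₀ (Real.exp_pos _), mul_comm]

lemma MemS.expDecay {V : (Fin M → ℝ) → ℝ} {f : (Fin M → ℝ) → ℂ} (h : MemS W V f) :
    ExpDecay W f :=
  (expDecay_iff_supNorm f).2 fun lam hlam => by simpa [Dpow_zero] using h.decay lam hlam 0

lemma MemS.expDecay_FT {V : (Fin M → ℝ) → ℝ} {f : (Fin M → ℝ) → ℂ} (h : MemS W V f) :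
    ExpDecay V (FT f) :=
  (expDecay_iff_supNorm _).2 fun lam hlam => by simpa [Dpow_zero] using h.decay_ft lam hlam 0

lemma memS_of_expDecay {V : (Fin M → ℝ) → ℝ} (hW : IsTamedWeight W) (hV : IsTamedWeight V)
    {f : SchwartzMap (Fin M → ℝ) ℂ} (hf : ExpDecay W f) (hf' : ExpDecay V (FT f)) :
    MemS W V f where
  integrable := f.integrable
  smooth := f.smooth _
  smooth_ft := coe_schwartzFT f ▸ (schwartzFT f).smooth _
  decay lam hlam α := (expDecay_iff_supNorm _).1 (hf.Dpow hW α) lam hlam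
  decay_ft lam hlam α := by
    rw [← coe_schwartzFT] at hf' ⊢
    exact (expDecay_iff_supNorm _).1 (hf'.Dpow hV α) lam hlam

end Derivatives

lemma le_add_mul_exp_neg_add {a A B u v : ℝ} (hA : 0 ≤ A) (hB : 0 ≤ B)
    (h₁ : a ≤ A * Real.exp (-(2 * u))) (h₂ : a ≤ B * Real.exp (-(2 * v))) :
    a ≤ (A + B) * Real.exp (-(u + v)) := by
  rcases le_total u v with huv | huv
  · exact h₂.trans (by gcongr <;> linarith)
  · exact h₁.trans (by gcongr <;> linarith)

/-- Characterization of membership in `S_Ω^Σ` through decay of the short-time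
Fourier transform (Theorem 2.9 of the paper, for Schwartz `f`). -/
theorem statement_4 (N : ℕ) (ω σ : Fin N → ℝ → ℝ)
    (hω : ∀ j, IsWeightFun (ω j)) (hσ : ∀ j, IsWeightFun (σ j))
    (g : (Fin N → ℝ) → ℂ) (hg : MemS (wSum ω) (wSum σ) g) (hg0 : g ≠ 0)
    (f : SchwartzMap ((Fin N → ℝ)) ℂ) :
    MemS (wSum ω) (wSum σ) (⇑f) ↔
      ∀ lam : ℝ, 0 < lam → ∃ C : ℝ, 0 < C ∧ ∀ x ξ : Fin N → ℝ,
        ‖STFT g (⇑f) x ξ‖ ≤ C * Real.exp (-(lam * (wSum ω x + wSum σ ξ))) := by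
  have hW := isTamedWeight_wSum hω
  have hV := isTamedWeight_wSum hσ
  have hgc := hg.smooth.continuous
  have hg'i := hg.expDecay_FT.integrable hV hg.smooth_ft.continuous
  have hpi : (0 : ℝ) < (2 * Real.pi) ^ N := pow_pos Real.two_pi_pos N
  have hnorm : ∀ x ξ, ‖STFT (FT g) (FT f) ξ x‖ = (2 * Real.pi) ^ N * ‖STFT g f (-x) ξ‖ :=
    fun x ξ => by
      rw [STFT_FT f.integrable hgc hg.integrable hg'i, norm_mul, norm_mul, norm_exp_neg_I_mul,
        norm_pow, norm_mul, Complex.norm_real, Complex.norm_ofNat,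
        Real.norm_of_nonneg Real.pi_pos.le, mul_one]
  constructor
  · intro hf lam hlam
    obtain ⟨A, hA, hA'⟩ := hf.expDecay.norm_STFT_le hW hg.expDecay (mul_pos two_pos hlam)
    obtain ⟨B, hB, hB'⟩ := hf.expDecay_FT.norm_STFT_le hV hg.expDecay_FT (mul_pos two_pos hlam)
    refine ⟨A + B / (2 * Real.pi) ^ N, by positivity, fun x ξ => ?_⟩
    rw [mul_add]
    refine le_add_mul_exp_neg_add hA.le (by positivity) ?_ ?_
    · simpa only [mul_assoc] using hA' x ξ
    · have := hB' ξ (-x)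
      rw [hnorm, neg_neg, mul_assoc] at this
      rw [div_mul_eq_mul_div]
      exact (le_div_iff₀' hpi).2 this
  · intro h
    refine memS_of_expDecay hW hV ?_ ?_
    · exact expDecay_of_norm_STFT_le hW hV f.continuous f.integrable hgc
        (hg.expDecay.exists_bound hW) hg0 h
    · have hg'0 : FT g ≠ 0 := fun h0 => hg0 <| funext fun t => by
        have := FT_FT hgc hg.integrable hg'i (-t)
        rw [h0, neg_neg] at this
        have hpi' : (2 * (Real.pi : ℂ)) ^ N ≠ 0 := by exact_mod_cast hpi.ne'
        simpa [FT, Real.pi_ne_zero] using this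
      refine expDecay_of_norm_STFT_le hV hW (continuous_FT f.integrable)
        (coe_schwartzFT f ▸ (schwartzFT f).integrable) hg.smooth_ft.continuous
        (hg.expDecay_FT.exists_bound hV) hg'0 fun lam hlam => ?_
      obtain ⟨C, hC, hC'⟩ := h lam hlam
      refine ⟨(2 * Real.pi) ^ N * C, by positivity, fun ξ x => ?_⟩
      rw [hnorm, mul_assoc]
      have := hC' (-x) ξ
      rw [hW.neg, add_comm] at this
      gcongr

end
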